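/- If f : (k+1)^V → ℝ is k-submodular, then its k-multilinear extension F is pairwise monotone: ∂F/∂x_{e,j1}(x) + ∂F/∂x_{e,j2}(x) ≥ 0 for every x ∈ Δ_k^V, every e ∈ V and all distinct j1, j2 ∈ {1,…,k}. -/

import Mathlib

open Finset

section KSubmodularDefs

variable {V : Type*} [Fintype V] [DecidableEq V] {k : ℕ}

/-- The support of a `k`-tuple `x : V → Fin (k+1)` (value `0` means "not selected"). -/
def ksupp (x : V → Fin (k+1)) : Finset V := Finset.univ.filter fun e => x e ≠ 0

/-- The meet `x ⊓ y`. -/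
def kinf (x y : V → Fin (k+1)) : V → Fin (k+1) :=
  fun e => if x e = y e then x e else 0

/-- The join `x ⊔ y`. -/
def ksup (x y : V → Fin (k+1)) : V → Fin (k+1) :=
  fun e => if y e = 0 ∨ y e = x e then x e else if x e = 0 then y e else 0

/-- `f` is `k`-submodular. -/
def KSubmodular (f : (V → Fin (k+1)) → ℝ) : Prop :=
  ∀ x y : V → Fin (k+1), f (ksup x y) + f (kinf x y) ≤ f x + f y

/-- The partial order `x ⪯ y` on `(k+1)^V`. -/
def kle (x y : V → Fin (k+1)) : Prop := ∀ e : V, x e = 0 ∨ x e = y e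

/-- `f` is monotone with respect to `⪯`. -/
def KMonotone (f : (V → Fin (k+1)) → ℝ) : Prop :=
  ∀ x y : V → Fin (k+1), kle x y → f x ≤ f y

/-- The marginal gain `Δ_{e,j}(x)` of assigning element `e` to component `j`. -/
def margin (f : (V → Fin (k+1)) → ℝ) (x : V → Fin (k+1)) (e : V) (j : Fin (k+1)) : ℝ :=
  f (Function.update x e j) - f x

/-- The total cost `c(x)` of a tuple. -/
def kcost (c : V → ℝ) (x : V → Fin (k+1)) : ℝ := ∑ e ∈ ksupp x, c e

/-- One step of a greedy sequence relative to `o`: pick `e ∉ supp x` and `j ∈ {1,…,k}`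
maximizing the marginal gain over components (a), and with marginal density at least that of
every pair `(e', j')` with `e' ∈ supp o \ supp x` (b). -/
def GreedyStep (f : (V → Fin (k+1)) → ℝ) (c : V → ℝ) (o : V → Fin (k+1))
    (x x' : V → Fin (k+1)) : Prop :=
  ∃ e : V, ∃ j : Fin (k+1), x e = 0 ∧ j ≠ 0 ∧ x' = Function.update x e j ∧
    (∀ j' : Fin (k+1), j' ≠ 0 → margin f x e j' ≤ margin f x e j) ∧
    (∀ e' : V, o e' ≠ 0 → x e' = 0 → ∀ j' : Fin (k+1), j' ≠ 0 →
      margin f x e' j' * c e ≤ margin f x e j * c e')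

/-- `GreedyRun f c B s V0 out`: starting from partial solution `s` with remaining elements `V0`,
the greedy procedure with budget `B` (under some tie-breaking) can terminate with output `out`.
At each step a pair `(e, j)` of maximum marginal density among remaining elements is chosen;
`e` is added (placed in component `j`) iff it fits in the remaining budget, and is removed
from the remaining pool in either case. -/
inductive GreedyRun (f : (V → Fin (k+1)) → ℝ) (c : V → ℝ) (B : ℝ) :
    (V → Fin (k+1)) → Finset V → (V → Fin (k+1)) → Prop where
  | done (s : V → Fin (k+1)) : GreedyRun f c B s ∅ s
  | take (s : V → Fin (k+1)) (V0 : Finset V) (e : V) (j : Fin (k+1))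
      (out : V → Fin (k+1)) (he : e ∈ V0) (hj : j ≠ 0)
      (hbest : ∀ e' ∈ V0, ∀ j' : Fin (k+1), j' ≠ 0 →
        margin f s e' j' / c e' ≤ margin f s e j / c e)
      (hfit : kcost c s + c e ≤ B)
      (hrest : GreedyRun f c B (Function.update s e j) (V0.erase e) out) :
      GreedyRun f c B s V0 out
  | skip (s : V → Fin (k+1)) (V0 : Finset V) (e : V) (j : Fin (k+1))
      (out : V → Fin (k+1)) (he : e ∈ V0) (hj : j ≠ 0)
      (hbest : ∀ e' ∈ V0, ∀ j' : Fin (k+1), j' ≠ 0 →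
        margin f s e' j' / c e' ≤ margin f s e j / c e)
      (hnofit : ¬ kcost c s + c e ≤ B)
      (hrest : GreedyRun f c B s (V0.erase e) out) :
      GreedyRun f c B s V0 out

/-- The `k`-multilinear extension of `f`, as a function of `x : V → Fin (k+1) → ℝ`
(only the coordinates `x e j` with `j ≠ 0` are relevant). -/
noncomputable def kext (f : (V → Fin (k+1)) → ℝ) (x : V → Fin (k+1) → ℝ) : ℝ :=
  ∑ s : V → Fin (k+1), f s *
    ∏ e : V,
      (if s e = 0 then 1 - ∑ j ∈ Finset.univ.erase (0 : Fin (k+1)), x e j else x e (s e))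

/-- The partial derivative of `F` with respect to the coordinate `(e, j)` at the point `x`. -/
noncomputable def pderiv (F : (V → Fin (k+1) → ℝ) → ℝ) (e : V) (j : Fin (k+1))
    (x : V → Fin (k+1) → ℝ) : ℝ :=
  deriv (fun t : ℝ => F (Function.update x e (Function.update (x e) j t))) (x e j)

/-- Membership in the domain `Δ_k^V` of the multilinear extension. -/
def inSimplex (x : V → Fin (k+1) → ℝ) : Prop :=
  (∀ e : V, ∀ j : Fin (k+1), j ≠ 0 → 0 ≤ x e j ∧ x e j ≤ 1) ∧
  (∀ e : V, ∑ j ∈ Finset.univ.erase (0 : Fin (k+1)), x e j ≤ 1)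

end KSubmodularDefs

section KextDerivative

variable {V : Type*} {k : ℕ}

/-- The probability that a random coordinate with marginals `p` takes the value `i`,
the value `0` receiving the remaining mass. -/
def kweight (p : Fin (k+1) → ℝ) (i : Fin (k+1)) : ℝ :=
  if i = 0 then 1 - ∑ j ∈ Finset.univ.erase (0 : Fin (k+1)), p j else p i

lemma kweight_nonneg {x : V → Fin (k+1) → ℝ} (hx : inSimplex x) (e : V) (i : Fin (k+1)) :
    0 ≤ kweight (x e) i := by
  unfold kweight
  split_ifs with h
  · linarith [hx.2 e]
  · exact (hx.1 e i h).1

lemma hasDerivAt_kweight_update (p : Fin (k+1) → ℝ) {j : Fin (k+1)} (hj : j ≠ 0)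
    (i : Fin (k+1)) (t : ℝ) :
    HasDerivAt (fun t : ℝ => kweight (Function.update p j t) i)
      ((if i = j then 1 else 0) - if i = 0 then 1 else 0) t := by
  unfold kweight
  by_cases hi : i = 0
  · subst hi
    have hmem : j ∈ Finset.univ.erase (0 : Fin (k+1)) := by simp [hj]
    simp only [if_true, Finset.sum_update_of_mem hmem, if_neg hj.symm]
    simpa using ((hasDerivAt_id t).add_const _).const_sub (1 : ℝ)
  · simp only [if_neg hi, sub_zero]
    by_cases hij : i = j
    · subst hij
      simpa using hasDerivAt_id' t
    · simpa [hij] using hasDerivAt_const t (p i)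

lemma kext_update [Fintype V] [DecidableEq V]
    (f : (V → Fin (k+1)) → ℝ) (x : V → Fin (k+1) → ℝ) (e : V)
    (p : Fin (k+1) → ℝ) :
    kext f (Function.update x e p) =
      ∑ s : V → Fin (k+1), f s * (kweight p (s e) *
        ∏ e' ∈ Finset.univ.erase e, kweight (x e') (s e')) := by
  refine Finset.sum_congr rfl fun s _ => ?_
  change f s * ∏ e' : V, kweight (Function.update x e p e') (s e') = _
  rw [← Finset.mul_prod_erase _ _ (Finset.mem_univ e), Function.update_self]
  congr 2
  refine Finset.prod_congr rfl fun e' he' => ?_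
  rw [Function.update_of_ne (Finset.ne_of_mem_erase he')]

lemma sum_filter_apply_eq [Fintype V] [DecidableEq V]
    (g : (V → Fin (k+1)) → ℝ) (e : V) (j : Fin (k+1)) :
    ∑ s with s e = j, g s = ∑ s with s e = 0, g (Function.update s e j) := by
  refine Finset.sum_nbij' (fun s => Function.update s e 0) (fun s => Function.update s e j)
    ?_ ?_ ?_ ?_ ?_
  · simp
  · simp
  · intro s hs
    simp [← (Finset.mem_filter.mp hs).2]
  · intro s hs
    simp [← (Finset.mem_filter.mp hs).2]
  · intro s hs
    simp [← (Finset.mem_filter.mp hs).2]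

/-- A partial derivative of the `k`-multilinear extension is a weighted sum of marginal gains. -/
lemma pderiv_kext [Fintype V] [DecidableEq V]
    (f : (V → Fin (k+1)) → ℝ) (x : V → Fin (k+1) → ℝ) (e : V)
    {j : Fin (k+1)} (hj : j ≠ 0) :
    pderiv (kext f) e j x =
      ∑ s with s e = 0,
        margin f s e j * ∏ e' ∈ Finset.univ.erase e, kweight (x e') (s e') := by
  have hderiv : pderiv (kext f) e j x =
      ∑ s : V → Fin (k+1), f s * (((if s e = j then 1 else 0) - if s e = 0 then 1 else 0) *
        ∏ e' ∈ Finset.univ.erase e, kweight (x e') (s e')) := by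
    unfold pderiv
    simp only [kext_update]
    exact (HasDerivAt.fun_sum fun s _ =>
      ((hasDerivAt_kweight_update (x e) hj (s e) (x e j)).mul_const _).const_mul (f s)).deriv
  have hprod (s : V → Fin (k+1)) :
      ∏ e' ∈ Finset.univ.erase e, kweight (x e') (Function.update s e j e') =
        ∏ e' ∈ Finset.univ.erase e, kweight (x e') (s e') :=
    Finset.prod_congr rfl fun e' he' => by
      rw [Function.update_of_ne (Finset.ne_of_mem_erase he')]
  rw [hderiv]
  simp only [sub_mul, mul_sub, ite_mul, one_mul, zero_mul, mul_ite, mul_zero,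
    Finset.sum_sub_distrib, ← Finset.sum_filter, margin]
  rw [sum_filter_apply_eq _ e j]
  simp only [hprod]

/-- Pairwise monotonicity of the marginal gains of a `k`-submodular function. -/
lemma KSubmodular.margin_add_margin_nonneg [DecidableEq V] {f : (V → Fin (k+1)) → ℝ}
    (hsub : KSubmodular f)
    {s : V → Fin (k+1)} {e : V} (hs : s e = 0) {j₁ j₂ : Fin (k+1)}
    (hj₁ : j₁ ≠ 0) (hj₂ : j₂ ≠ 0) (hne : j₁ ≠ j₂) :
    0 ≤ margin f s e j₁ + margin f s e j₂ := by
  have hsup : ksup (Function.update s e j₁) (Function.update s e j₂) = s := by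
    funext e'
    by_cases h : e' = e
    · subst h
      simp [ksup, hs, hj₁, hj₂, hne.symm]
    · simp [ksup, h]
  have hinf : kinf (Function.update s e j₁) (Function.update s e j₂) = s := by
    funext e'
    by_cases h : e' = e
    · subst h
      simp [kinf, hs, hne]
    · simp [kinf, h]
  have h := hsub (Function.update s e j₁) (Function.update s e j₂)
  rw [hsup, hinf] at h
  unfold margin
  linarith

end KextDerivative

/-- If `f` is `k`-submodular, its `k`-multilinear extension is pairwise
monotone on `Δ_k^V`: the partial derivatives at any point, in two distinct components of the
same element, sum to a nonnegative number. -/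
theorem kext_pairwise_monotone
    {V : Type*} [Fintype V] [DecidableEq V] {k : ℕ} (hk : 1 ≤ k)
    (f : (V → Fin (k+1)) → ℝ) (hsub : KSubmodular f)
    (x : V → Fin (k+1) → ℝ) (hx : inSimplex x)
    (e : V) (j₁ j₂ : Fin (k+1)) (hj₁ : j₁ ≠ 0) (hj₂ : j₂ ≠ 0) (hne : j₁ ≠ j₂) :
    0 ≤ pderiv (kext f) e j₁ x + pderiv (kext f) e j₂ x := by
  rw [pderiv_kext f x e hj₁, pderiv_kext f x e hj₂, ← Finset.sum_add_distrib]
  refine Finset.sum_nonneg fun s hs => ?_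
  rw [← add_mul]
  exact mul_nonneg
    (hsub.margin_add_margin_nonneg (Finset.mem_filter.mp hs).2 hj₁ hj₂ hne)
    (Finset.prod_nonneg fun e' _ => kweight_nonneg hx e' (s e'))
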